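/- Let n and k be integers with 1 ≤ k ≤ n−3, and let G ∈ 𝒢_n^k be such that G ⪯_s H for every H ∈ 𝒢_n^k (i.e., G is first in the S-order among 𝒢_n^k). Then G contains exactly one cycle; equivalently, G is a connected unicyclic graph with exactly n edges. -/

import Mathlib

open SimpleGraph

/-- The `k`-th spectral moment of a graph: the trace of the `k`-th power of its
adjacency matrix. -/
noncomputable def specMoment {V : Type*} [Fintype V] (G : SimpleGraph V) (k : ℕ) : ℝ :=
  letI := Classical.decEq V
  letI : DecidableRel G.Adj := Classical.decRel _
  Matrix.trace ((G.adjMatrix ℝ) ^ k)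

/-- The strict lexicographic order by spectral moments (`S`-order) for graphs on
`n` vertices. -/
def SLt {V W : Type*} [Fintype V] [Fintype W] (n : ℕ)
    (G : SimpleGraph V) (H : SimpleGraph W) : Prop :=
  ∃ k, 1 ≤ k ∧ k ≤ n - 1 ∧ (∀ i, i < k → specMoment G i = specMoment H i) ∧
    specMoment G k < specMoment H k

/-- The weak `S`-order: `G ⪯_s H` iff `G ≺_s H` or all spectral moments
`S_0, …, S_{n-1}` of `G` and `H` coincide. -/
def SLe {V W : Type*} [Fintype V] [Fintype W] (n : ℕ)
    (G : SimpleGraph V) (H : SimpleGraph W) : Prop :=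
  SLt n G H ∨ ∀ i, i < n → specMoment G i = specMoment H i

/-- The number of cut edges (bridges) of a graph. -/
noncomputable def numBridges {V : Type*} (G : SimpleGraph V) : ℕ :=
  {e : Sym2 V | G.IsBridge e}.ncard

/-- The cycle `0, 1, …, d` followed by the path `d, d + 1, …, n - 1`. -/
def tadpole (n d : ℕ) (hd : 2 ≤ d) : SimpleGraph (Fin n) where
  Adj u v := u.val + 1 = v.val ∨ v.val + 1 = u.val ∨ (u.val = 0 ∧ v.val = d) ∨
    (v.val = 0 ∧ u.val = d)
  symm := ⟨fun u v h => by grind⟩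
  loopless := ⟨fun u h => by grind⟩

theorem tadpole_adj (n d : ℕ) (hd : 2 ≤ d) (u v : Fin n) : (tadpole n d hd).Adj u v ↔
    (u.val + 1 = v.val ∨ v.val + 1 = u.val ∨ (u.val = 0 ∧ v.val = d) ∨
    (v.val = 0 ∧ u.val = d)) := Iff.rfl

theorem segment_reachable {n : ℕ} (H : SimpleGraph (Fin n)) (a b : ℕ) (hab : a ≤ b) (hb : b < n)
    (h : ∀ j, a ≤ j → ∀ hj : j < b, H.Adj ⟨j, by omega⟩ ⟨j + 1, by omega⟩) :
    H.Reachable ⟨a, by omega⟩ ⟨b, hb⟩ := by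
  induction b, hab using Nat.le_induction with
  | base => exact Reachable.refl _
  | succ b hab ih =>
    exact (ih (by omega) (fun j h1 h2 => h j h1 (by omega))).trans
      (h b hab (by omega)).reachable

theorem tadpole_connected (n d : ℕ) (hd : 2 ≤ d) (hdn : d < n) : (tadpole n d hd).Connected := by
  obtain ⟨m, rfl⟩ : ∃ m, n = m + 1 := ⟨n - 1, by omega⟩
  refine (pathGraph_connected m).mono ?_
  intro u v h
  rw [pathGraph_adj] at h
  rw [tadpole_adj]
  tauto

theorem bridge_adj {V : Type*} {G : SimpleGraph V} (hG : G.Connected) {u v : V}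
    (h : G.IsBridge s(u, v)) : G.Adj u v :=
  h.reachable_iff_adj.1 (hG.preconnected u v)

theorem tadpole_not_bridge (n d : ℕ) (hd : 2 ≤ d) (hdn : d < n) (i : ℕ) (hi : i < d) :
    ¬ (tadpole n d hd).IsBridge s(⟨i, by omega⟩, ⟨i + 1, by omega⟩) := by
  rw [isBridge_iff, not_not]
  have p : i < n := by omega
  have q : i + 1 < n := by omega
  have h1 := segment_reachable ((tadpole n d hd).deleteEdges
    {s(⟨i, p⟩, ⟨i + 1, q⟩)}) 0 i (by omega) (by omega)
    (fun j h1 h2 => by simp [tadpole_adj]; omega)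
  have h2 := segment_reachable ((tadpole n d hd).deleteEdges
    {s(⟨i, p⟩, ⟨i + 1, q⟩)}) (i + 1) d (by omega) (by omega)
    (fun j h1 h2 => by simp [tadpole_adj]; omega)
  have h3 : ((tadpole n d hd).deleteEdges
    {s(⟨i, p⟩, ⟨i + 1, q⟩)}).Adj ⟨0, by omega⟩ ⟨d, by omega⟩ := by
    simp [tadpole_adj]; omega
  exact h1.symm.trans (h3.reachable.trans h2.symm)

theorem tadpole_not_bridge_chord (n d : ℕ) (hd : 2 ≤ d) (hdn : d < n) :
    ¬ (tadpole n d hd).IsBridge s(⟨0, by omega⟩, ⟨d, by omega⟩) := by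
  rw [isBridge_iff, not_not]
  have p : 0 < n := by omega
  exact segment_reachable ((tadpole n d hd).deleteEdges
    {s(⟨0, p⟩, ⟨d, hdn⟩)}) 0 d (by omega) (by omega)
    (fun j h1 h2 => by simp [tadpole_adj]; omega)

theorem tadpole_bridge (n d : ℕ) (hd : 2 ≤ d) (i : ℕ) (hi : d ≤ i) (hin : i + 1 < n) :
    (tadpole n d hd).IsBridge s(⟨i, by omega⟩, ⟨i + 1, by omega⟩) := by
  rw [isBridge_iff]
  rintro ⟨w⟩
  have key : ∀ (u v : Fin n), ((tadpole n d hd).deleteEdges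
    {s(⟨i, by omega⟩, ⟨i + 1, by omega⟩)}).Walk u v → u.val ≤ i → v.val ≤ i := by
    intro u v w
    induction w with
    | nil => exact id
    | cons h p ih =>
      intro hu
      apply ih
      simp [tadpole_adj, Fin.ext_iff] at h
      omega
  have := key _ _ w le_rfl
  simp at this

theorem tadpole_bridges (n d : ℕ) (hd : 2 ≤ d) (hdn : d < n) :
    numBridges (tadpole n d hd) = n - 1 - d := by
  have : {e : Sym2 (Fin n) | (tadpole n d hd).IsBridge e} =
      Set.range (fun i : Fin (n - 1 - d) =>
        (s(⟨d + i, by omega⟩, ⟨d + i + 1, by omega⟩) : Sym2 (Fin n))) := by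
    ext e
    constructor
    · induction e with | h u v =>
      intro h
      have hadj := bridge_adj (tadpole_connected n d hd hdn) h
      obtain ⟨u, hu⟩ := u
      obtain ⟨v, hv⟩ := v
      simp only [Set.mem_ofPred_eq] at h
      rw [tadpole_adj] at hadj
      simp only at hadj
      rcases hadj with rfl | rfl | ⟨rfl, rfl⟩ | ⟨rfl, rfl⟩
      · by_cases hc : u < d
        · exact absurd h (tadpole_not_bridge n d hd hdn u hc)
        · exact ⟨⟨u - d, by omega⟩, by simp; omega⟩
      · rw [Sym2.eq_swap] at h
        by_cases hc : v < d
        · exact absurd h (tadpole_not_bridge n d hd hdn v hc)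
        · exact ⟨⟨v - d, by omega⟩, by simp; omega⟩
      · exact absurd h (tadpole_not_bridge_chord n _ hd hdn)
      · rw [Sym2.eq_swap] at h
        exact absurd h (tadpole_not_bridge_chord n _ hd hdn)
    · rintro ⟨i, rfl⟩
      exact tadpole_bridge n d hd (d + i) (by omega) (by omega)
  rw [numBridges, this, ← Set.image_univ, Set.ncard_image_of_injective]
  · simp
  · intro i j h
    simp at h
    omega

theorem tadpole_edges (n d : ℕ) (hd : 2 ≤ d) (hdn : d < n) :
    (tadpole n d hd).edgeSet.ncard ≤ n := by
  have hsub : (tadpole n d hd).edgeSet ⊆ insert s(⟨0, by omega⟩, ⟨d, hdn⟩)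
      (Set.range (fun i : Fin (n - 1) =>
        (s(⟨i, by omega⟩, ⟨i + 1, by omega⟩) : Sym2 (Fin n)))) := by
    intro e
    induction e with | h u v =>
    intro hadj
    rw [mem_edgeSet, tadpole_adj] at hadj
    obtain ⟨u, hu⟩ := u
    obtain ⟨v, hv⟩ := v
    simp only at hadj
    rcases hadj with rfl | rfl | ⟨rfl, rfl⟩ | ⟨rfl, rfl⟩
    · exact Or.inr ⟨⟨u, by omega⟩, rfl⟩
    · exact Or.inr ⟨⟨v, by omega⟩, Sym2.eq_swap⟩
    · exact Or.inl rfl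
    · exact Or.inl Sym2.eq_swap
  have h1 := Set.ncard_le_ncard hsub (Set.toFinite _)
  have h2 := Set.ncard_insert_le (s(⟨0, by omega⟩, ⟨d, hdn⟩) : Sym2 (Fin n))
      (Set.range (fun i : Fin (n - 1) =>
        (s(⟨i, by omega⟩, ⟨i + 1, by omega⟩) : Sym2 (Fin n))))
  have h3 := Set.ncard_image_le (f := fun i : Fin (n - 1) =>
        (s(⟨i, by omega⟩, ⟨i + 1, by omega⟩) : Sym2 (Fin n))) (s := Set.univ) (Set.toFinite _)
  rw [Set.image_univ] at h3
  simp only [Set.ncard_univ, Nat.card_eq_fintype_card, Fintype.card_fin] at h3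
  omega

theorem specMoment_one {V : Type*} [Fintype V] (G : SimpleGraph V) : specMoment G 1 = 0 := by
  simp [specMoment]

theorem specMoment_two {V : Type*} [Fintype V] (G : SimpleGraph V) :
    specMoment G 2 = 2 * (G.edgeSet.ncard : ℝ) := by
  classical
  have h := G.sum_degrees_eq_twice_card_edges
  have h2 : G.edgeSet.ncard = G.edgeFinset.card := by
    rw [← coe_edgeFinset, Set.ncard_coe_finset]
  rw [h2]
  have h3 : ((∑ v, G.degree v : ℕ) : ℝ) = 2 * (G.edgeFinset.card : ℝ) := by exact_mod_cast h
  rw [← h3, Nat.cast_sum, specMoment]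
  simp only [pow_two, Matrix.trace, Matrix.diag]
  refine Finset.sum_congr rfl fun i _ => ?_
  rw [adjMatrix_mul_self_apply_self]

theorem edges_ge (n k : ℕ) (hn : 3 ≤ n) (hk : k ≤ n - 3)
    (G : SimpleGraph (Fin n)) (hconn : G.Connected) (hbr : numBridges G = k) :
    n ≤ G.edgeSet.ncard := by
  have h1 := hconn.card_vert_le_card_edgeSet_add_one
  rw [Nat.card_coe_set_eq, Nat.card_eq_fintype_card, Fintype.card_fin] at h1
  by_contra hlt
  have hT : G.IsTree := isTree_iff_connected_and_card.2 ⟨hconn, by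
    rw [Nat.card_coe_set_eq, Nat.card_eq_fintype_card, Fintype.card_fin]; omega⟩
  have hsub : G.edgeSet ⊆ {e : Sym2 (Fin n) | G.IsBridge e} := by
    intro e
    induction e with | h u v =>
    intro h
    exact isAcyclic_iff_forall_adj_isBridge.1 hT.isAcyclic h
  have := Set.ncard_le_ncard hsub (Set.toFinite _)
  rw [numBridges] at hbr
  omega

/-- If `G` is first in the `S`-order among connected `n`-vertex graphs with `k`
cut edges (`1 ≤ k ≤ n - 3`), then `G` contains exactly one cycle; equivalently,
`G` is a connected unicyclic graph, i.e. it has exactly `n` edges. -/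
theorem first_is_unicyclic (n k : ℕ) (hn : 3 ≤ n) (hk1 : 1 ≤ k) (hk : k ≤ n - 3)
    (G : SimpleGraph (Fin n)) (hconn : G.Connected) (hbr : numBridges G = k)
    (hfirst : ∀ H : SimpleGraph (Fin n), H.Connected → numBridges H = k →
      SLe n G H) :
    G.edgeSet.ncard = n := by
  have hge := edges_ge n k hn hk G hconn hbr
  have hd : 2 ≤ n - 1 - k := by omega
  have hle := tadpole_edges n (n - 1 - k) hd (by omega)
  have hS := hfirst (tadpole n (n - 1 - k) hd) (tadpole_connected _ _ _ (by omega))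
    (by rw [tadpole_bridges _ _ _ (by omega)]; omega)
  have h2 : specMoment G 2 ≤ specMoment (tadpole n (n - 1 - k) hd) 2 := by
    rcases hS with ⟨j, hj1, -, heq, hlt⟩ | h
    · rcases Nat.lt_trichotomy j 2 with h | rfl | h
      · obtain rfl : j = 1 := by omega
        rw [specMoment_one, specMoment_one] at hlt
        exact absurd hlt (lt_irrefl _)
      · exact hlt.le
      · exact (heq 2 h).le
    · exact (h 2 (by omega)).le
  rw [specMoment_two, specMoment_two] at h2
  have h3 : (G.edgeSet.ncard : ℝ) ≤ ((tadpole n (n - 1 - k) hd).edgeSet.ncard : ℝ) := by linarith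
  have h4 : G.edgeSet.ncard ≤ (tadpole n (n - 1 - k) hd).edgeSet.ncard := by exact_mod_cast h3
  omega
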